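/- arXiv:2304.05491 — 3 statements merged into one kernel-verified Lean document; each statement's English description precedes it below -/
import Mathlib

section
/- Let f, g : ℝ → ℝ be nonnegative measurable functions with ∫ f dλ = 1 and ∫ g dλ = 1 (λ Lebesgue measure), and f > 0 almost everywhere. Assume that the map α ↦ ∫ f^{1+α} dλ is differentiable at 0, that the map α ↦ ∫ f^α g dλ is differentiable at 0 with derivative at 0 equal to ∫ g · log f dλ (which is assumed finite, i.e. g·log f is integrable). Then lim_{α→0⁺} [ −(∫ f^α g dλ)/(α·(∫ f^{1+α} dλ)^{α/(α+1)}) + 1/α ] = −∫ g · log f dλ. -/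
open Filter Real MeasureTheory

/-- If `A` is differentiable at `0` with `A 0 = 1`, then multiplying by the normalising factor
`A α ^ (-(α / (α + 1)))` changes neither the value nor the derivative at `0` of a function. -/
theorem hasDerivAt_div_rpow_div_add_one {A B : ℝ → ℝ} {b : ℝ} (hA : DifferentiableAt ℝ A 0)
    (hA0 : A 0 = 1) (hB : HasDerivAt B b 0) :
    HasDerivAt (fun α => B α / A α ^ (α / (α + 1))) b 0 := by
  have hexp : HasDerivAt (fun α : ℝ => α / (α + 1)) 1 0 := by
    simpa using (hasDerivAt_id (0 : ℝ)).fun_div ((hasDerivAt_id (0 : ℝ)).add_const 1) (by simp)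
  have hpow : HasDerivAt (fun α => A α ^ (α / (α + 1))) 0 0 := by
    simpa [hA0] using hA.hasDerivAt.rpow hexp (by simp [hA0])
  simpa using hB.fun_div hpow (by simp)

/-- If `H` has derivative `b` at `0` and `H 0 = 1`, then `-H α / α + 1 / α → -b`. -/
theorem HasDerivAt.tendsto_neg_div_add_one_div {H : ℝ → ℝ} {b : ℝ} (hH : HasDerivAt H b 0)
    (hH0 : H 0 = 1) :
    Tendsto (fun α => -H α / α + 1 / α) (nhdsWithin 0 (Set.Ioi 0)) (nhds (-b)) := by
  refine hH.tendsto_slope_zero_right.neg.congr fun α => ?_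
  rw [zero_add, hH0, smul_eq_mul]
  ring

/-- Lemma 1 of the paper: for probability densities `f, g` on `ℝ` with `f > 0`
a.e., if `α ↦ ∫ f^(1+α)` is differentiable at `0` and `α ↦ ∫ f^α g` has derivative
`∫ g log f` at `0` (with `g · log f` integrable), then the modified Rényi objective
`-(∫ f^α g)/(α (∫ f^(1+α))^(α/(α+1))) + 1/α` tends to `-∫ g log f` as `α → 0⁺`. -/
theorem renyi_objective_limit (f g : ℝ → ℝ)
    (hfm : Measurable f) (hgm : Measurable g)
    (hf0 : ∀ y, 0 ≤ f y) (hg0 : ∀ y, 0 ≤ g y)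
    (hf1 : ∫ y, f y = 1) (hg1 : ∫ y, g y = 1)
    (hfpos : ∀ᵐ y, 0 < f y)
    (hA : DifferentiableAt ℝ (fun α : ℝ => ∫ y, f y ^ (1 + α)) 0)
    (hint : Integrable (fun y => g y * Real.log (f y)))
    (hB : HasDerivAt (fun α : ℝ => ∫ y, f y ^ α * g y)
      (∫ y, g y * Real.log (f y)) 0) :
    Tendsto
      (fun α : ℝ =>
        -(∫ y, f y ^ α * g y) / (α * (∫ y, f y ^ (1 + α)) ^ (α / (α + 1))) + 1 / α)
      (nhdsWithin 0 (Set.Ioi 0))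
      (nhds (-∫ y, g y * Real.log (f y))) := by
  have hA0 : ∫ y, f y ^ (1 + (0 : ℝ)) = 1 := by simpa using hf1
  have hH := hasDerivAt_div_rpow_div_add_one hA hA0 hB
  refine (hH.tendsto_neg_div_add_one_div (by simpa using hg1)).congr fun α => ?_
  rw [← neg_div, div_div, mul_comm α]
end

section
/- Let α > 0 and let f, g : ℝ → ℝ be nonnegative measurable functions with ∫ f dλ = 1 and ∫ g dλ = 1 (λ Lebesgue measure). Assume that ∫ f^{α+1} dλ and ∫ g^{α+1} dλ are finite and positive and that ∫ f^α g dλ is finite and positive. Then R_α(f,g) = 0 if and only if f = g almost everywhere with respect to Lebesgue measure. -/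
open Real MeasureTheory

/-- Equality case of Hölder's inequality for nonnegative functions, in terms of the geometric mean
`u ^ a * v ^ b` with weights `a + b = 1`. -/
theorem integral_rpow_mul_rpow_eq_iff {Ω : Type*} [MeasurableSpace Ω] {μ : Measure Ω}
    {u v : Ω → ℝ} {a b : ℝ} (ha : 0 < a) (hb : 0 < b) (hab : a + b = 1)
    (hu0 : ∀ x, 0 ≤ u x) (hv0 : ∀ x, 0 ≤ v x) (hu : Integrable u μ) (hv : Integrable v μ)
    (hupos : 0 < ∫ x, u x ∂μ) (hvpos : 0 < ∫ x, v x ∂μ) :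
    ∫ x, u x ^ a * v x ^ b ∂μ = (∫ x, u x ∂μ) ^ a * (∫ x, v x ∂μ) ^ b ↔
      ∀ᵐ x ∂μ, u x / (∫ x, u x ∂μ) = v x / (∫ x, v x ∂μ) := by
  set U := ∫ x, u x ∂μ with hU
  set V := ∫ x, v x ∂μ with hV
  have hp0 : ∀ x, 0 ≤ u x / U := fun x => div_nonneg (hu0 x) hupos.le
  have hq0 : ∀ x, 0 ≤ v x / V := fun x => div_nonneg (hv0 x) hvpos.le
  have hUV : 0 < U ^ a * V ^ b := by positivity
  have hgeom : ∀ x, (u x / U) ^ a * (v x / V) ^ b = u x ^ a * v x ^ b / (U ^ a * V ^ b) := by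
    intro x
    rw [div_rpow (hu0 x) hupos.le, div_rpow (hv0 x) hvpos.le, div_mul_div_comm]
  have hle : ∀ x, (u x / U) ^ a * (v x / V) ^ b ≤ a * (u x / U) + b * (v x / V) := fun x =>
    geom_mean_le_arith_mean2_weighted ha.le hb.le (hp0 x) (hq0 x) hab
  have hiu : Integrable (fun x => a * (u x / U)) μ := (hu.div_const U).const_mul a
  have hiv : Integrable (fun x => b * (v x / V)) μ := (hv.div_const V).const_mul b
  have hig : Integrable (fun x => (u x / U) ^ a * (v x / V) ^ b) μ := by
    refine (hiu.add hiv).mono' ?_ (Filter.Eventually.of_forall fun x => ?_)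
    · exact (((hu.aemeasurable.div_const U).pow_const a).mul
        ((hv.aemeasurable.div_const V).pow_const b)).aestronglyMeasurable
    · rw [Real.norm_of_nonneg (mul_nonneg (rpow_nonneg (hp0 x) a) (rpow_nonneg (hq0 x) b))]
      exact hle x
  have harith : ∫ x, (a * (u x / U) + b * (v x / V)) ∂μ = 1 := by
    rw [integral_add hiu hiv, integral_const_mul, integral_const_mul, integral_div, integral_div,
      ← hU, ← hV, div_self hupos.ne', div_self hvpos.ne', mul_one, mul_one, hab]
  calc ∫ x, u x ^ a * v x ^ b ∂μ = U ^ a * V ^ b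
      ↔ ∫ x, (u x / U) ^ a * (v x / V) ^ b ∂μ = ∫ x, (a * (u x / U) + b * (v x / V)) ∂μ := by
        simp_rw [harith, hgeom]
        rw [integral_div, div_eq_one_iff_eq hUV.ne']
    _ ↔ ∀ᵐ x ∂μ, (u x / U) ^ a * (v x / V) ^ b = a * (u x / U) + b * (v x / V) :=
        integral_eq_iff_of_ae_le hig (hiu.add hiv) (Filter.Eventually.of_forall hle)
    _ ↔ ∀ᵐ x ∂μ, u x / U = v x / V := by
        simp_rw [geom_mean_eq_arith_mean2_weighted_iff_of_pos ha hb (hp0 _) (hq0 _) hab]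

/-- Two densities are almost everywhere equal as soon as their powers are proportional. -/
theorem ae_eq_of_rpow_div_eq {Ω : Type*} [MeasurableSpace Ω] {μ : Measure Ω} {f g : Ω → ℝ}
    {p A B : ℝ} (hp : 0 < p) (hA : 0 < A) (hB : 0 < B) (hf0 : ∀ x, 0 ≤ f x) (hg0 : ∀ x, 0 ≤ g x)
    (hf1 : ∫ x, f x ∂μ = 1) (hg1 : ∫ x, g x ∂μ = 1)
    (h : ∀ᵐ x ∂μ, f x ^ p / A = g x ^ p / B) : f =ᵐ[μ] g := by
  have hfg : ∀ᵐ x ∂μ, f x = (A / B) ^ p⁻¹ * g x := by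
    filter_upwards [h] with x hx
    have hx' : f x ^ p = A / B * g x ^ p := by
      rw [div_eq_iff hA.ne'] at hx
      rw [hx]
      ring
    rw [← rpow_rpow_inv (hf0 x) hp.ne', hx', mul_rpow (by positivity) (rpow_nonneg (hg0 x) p),
      rpow_rpow_inv (hg0 x) hp.ne']
  have hc : (A / B) ^ p⁻¹ = 1 := by
    rw [integral_congr_ae hfg, integral_const_mul, hg1, mul_one] at hf1
    exact hf1
  filter_upwards [hfg] with x hx
  rw [hx, hc, one_mul]

/-- the Rényi pseudodistance `R_α(f,g)` of tuning parameter `α > 0` between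
probability densities `f, g` on `ℝ` vanishes if and only if `f = g` almost everywhere
with respect to Lebesgue measure. -/
theorem renyi_pseudodistance_eq_zero_iff (α : ℝ) (hα : 0 < α) (f g : ℝ → ℝ)
    (hfm : Measurable f) (hgm : Measurable g)
    (hf0 : ∀ y, 0 ≤ f y) (hg0 : ∀ y, 0 ≤ g y)
    (hf1 : ∫ y, f y = 1) (hg1 : ∫ y, g y = 1)
    (hfint : Integrable (fun y => f y ^ (α + 1)))
    (hfpos : 0 < ∫ y, f y ^ (α + 1))
    (hgint : Integrable (fun y => g y ^ (α + 1)))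
    (hgpos : 0 < ∫ y, g y ^ (α + 1))
    (hfgint : Integrable (fun y => f y ^ α * g y))
    (hfgpos : 0 < ∫ y, f y ^ α * g y) :
    ((1 / (α + 1)) * Real.log (∫ y, f y ^ (α + 1))
        - (1 / α) * Real.log (∫ y, f y ^ α * g y)
        + (1 / (α * (α + 1))) * Real.log (∫ y, g y ^ (α + 1)) = 0)
      ↔ f =ᵐ[volume] g := by
  have hα1 : 0 < α + 1 := by linarith
  have hholder := integral_rpow_mul_rpow_eq_iff (a := α / (α + 1)) (b := 1 / (α + 1))
    (by positivity) (by positivity) (by field_simp) (fun y => rpow_nonneg (hf0 y) (α + 1))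
    (fun y => rpow_nonneg (hg0 y) (α + 1)) hfint hgint hfpos hgpos
  have hprod : ∀ y, (f y ^ (α + 1)) ^ (α / (α + 1)) * (g y ^ (α + 1)) ^ (1 / (α + 1))
      = f y ^ α * g y := by
    intro y
    rw [← rpow_mul (hf0 y), ← rpow_mul (hg0 y), mul_div_cancel₀ _ hα1.ne',
      mul_one_div_cancel hα1.ne', rpow_one]
  simp_rw [hprod] at hholder
  set A := ∫ y, f y ^ (α + 1)
  set B := ∫ y, g y ^ (α + 1)
  set C := ∫ y, f y ^ α * g y
  have hlog : 1 / (α + 1) * Real.log A - 1 / α * Real.log C + 1 / (α * (α + 1)) * Real.log B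
      = 1 / α * (Real.log (A ^ (α / (α + 1)) * B ^ (1 / (α + 1))) - Real.log C) := by
    rw [Real.log_mul (by positivity) (by positivity), Real.log_rpow hfpos, Real.log_rpow hgpos]
    field_simp
    ring
  have hzero : 1 / (α + 1) * Real.log A - 1 / α * Real.log C + 1 / (α * (α + 1)) * Real.log B = 0
      ↔ C = A ^ (α / (α + 1)) * B ^ (1 / (α + 1)) := by
    rw [hlog, mul_eq_zero_iff_left (by positivity), sub_eq_zero, eq_comm]
    exact Real.log_injOn_pos.eq_iff hfgpos (Set.mem_Ioi.2 (by positivity))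
  rw [hzero, hholder]
  refine ⟨ae_eq_of_rpow_div_eq hα1 hfpos hgpos hf0 hg0 hf1 hg1, fun h => ?_⟩
  have hAB : A = B := integral_congr_ae (h.mono fun y hy => by simp only [hy])
  filter_upwards [h] with y hy
  rw [hy, hAB]
end

section
/- Let p ≥ 1, let S be an invertible p×p real matrix, and let α > 0, K₁ > 0, σ > 0 be real numbers. Define the (p+1)×(p+1) block-diagonal matrices Ψ = K₁·(α+1)^(−3/2)·diag(S, 2/(α+1)) and Ω = K₁²·σ²·(2α+1)^(−3/2)·diag(S, (3α²+4α+2)/((α+1)²(2α+1))), where diag(S, c) denotes the block matrix with top-left p×p block S, bottom-right 1×1 block c, and zero off-diagonal blocks. Then Ψ is invertible and trace(Ω·Ψ⁻¹) = σ²·K₁·((α+1)/(2α+1))^(3/2)·( p + (3α²+4α+2)/(2·(2α+1)·(α+1)) ). -/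
open Matrix Real

/-- The right inverse of `a • diag(S, d)` is `a⁻¹ • diag(S⁻¹, d⁻¹)`. -/
theorem smul_fromBlocks_diag_mul_inv {m n K : Type*} [Fintype m] [DecidableEq m] [Fintype n]
    [DecidableEq n] [Field K] {S : Matrix m m K} (hS : IsUnit S) {a d : K} (ha : a ≠ 0)
    (hd : d ≠ 0) :
    (a • Matrix.fromBlocks S 0 0 (d • (1 : Matrix n n K))) *
      (a⁻¹ • Matrix.fromBlocks S⁻¹ 0 0 (d⁻¹ • (1 : Matrix n n K))) = 1 := by
  have hdet : IsUnit S.det := (Matrix.isUnit_iff_isUnit_det S).1 hS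
  rw [Matrix.smul_mul, Matrix.mul_smul, smul_smul, mul_inv_cancel₀ ha, one_smul,
    Matrix.fromBlocks_multiply]
  simp [Matrix.mul_nonsing_inv S hdet, smul_smul, hd, Matrix.fromBlocks_one]

/-- The trace of `b • diag(S, e)` times the inverse of `a • diag(S, d)`. -/
theorem trace_smul_fromBlocks_diag_mul_inv {m n K : Type*} [Fintype m] [DecidableEq m]
    [Fintype n] [DecidableEq n] [Field K] {S : Matrix m m K} (hS : IsUnit S) {a d : K}
    (ha : a ≠ 0) (hd : d ≠ 0) (b e : K) :
    Matrix.trace ((b • Matrix.fromBlocks S 0 0 (e • (1 : Matrix n n K))) *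
      (a • Matrix.fromBlocks S 0 0 (d • (1 : Matrix n n K)))⁻¹) =
      b / a * (Fintype.card m + e / d * Fintype.card n) := by
  have hdet : IsUnit S.det := (Matrix.isUnit_iff_isUnit_det S).1 hS
  rw [Matrix.inv_eq_right_inv (smul_fromBlocks_diag_mul_inv hS ha hd), Matrix.smul_mul,
    Matrix.mul_smul, smul_smul, Matrix.fromBlocks_multiply]
  simp [Matrix.mul_nonsing_inv S hdet, smul_smul, Matrix.trace, div_eq_mul_inv]
  ring

/-- trace/penalty computation of Section 3.1 of the paper: for the
block-diagonal matrices `Ψ = K₁ (α+1)^(−3/2) diag(S, 2/(α+1))` and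
`Ω = K₁² σ² (2α+1)^(−3/2) diag(S, (3α²+4α+2)/((α+1)²(2α+1)))` with `S` invertible,
`Ψ` is invertible and
`trace(Ω Ψ⁻¹) = σ² K₁ ((α+1)/(2α+1))^(3/2) (p + (3α²+4α+2)/(2(2α+1)(α+1)))`. -/
theorem trace_penalty_mlrm (p : ℕ) (hp : 1 ≤ p) (S : Matrix (Fin p) (Fin p) ℝ)
    (hS : IsUnit S) (α K₁ σ : ℝ) (hα : 0 < α) (hK : 0 < K₁) (hσ : 0 < σ) :
    IsUnit ((K₁ * (α + 1) ^ (-(3 / 2 : ℝ))) •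
        Matrix.fromBlocks S 0 0 ((2 / (α + 1)) • (1 : Matrix Unit Unit ℝ))) ∧
      Matrix.trace
        (((K₁ ^ 2 * σ ^ 2 * (2 * α + 1) ^ (-(3 / 2 : ℝ))) •
            Matrix.fromBlocks S 0 0
              (((3 * α ^ 2 + 4 * α + 2) / ((α + 1) ^ 2 * (2 * α + 1))) •
                (1 : Matrix Unit Unit ℝ))) *
          ((K₁ * (α + 1) ^ (-(3 / 2 : ℝ))) •
              Matrix.fromBlocks S 0 0 ((2 / (α + 1)) • (1 : Matrix Unit Unit ℝ)))⁻¹)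
        = σ ^ 2 * K₁ * ((α + 1) / (2 * α + 1)) ^ ((3 : ℝ) / 2) *
            (p + (3 * α ^ 2 + 4 * α + 2) / (2 * (2 * α + 1) * (α + 1))) := by
  have hα₁ : 0 < α + 1 := by linarith
  have hα₂ : 0 < 2 * α + 1 := by linarith
  have hpow : 0 < (α + 1) ^ (3 / 2 : ℝ) := Real.rpow_pos_of_pos hα₁ _
  have hpow' : 0 < (2 * α + 1) ^ (3 / 2 : ℝ) := Real.rpow_pos_of_pos hα₂ _
  have ha : K₁ * (α + 1) ^ (-(3 / 2 : ℝ)) ≠ 0 :=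
    (mul_pos hK (Real.rpow_pos_of_pos hα₁ _)).ne'
  have hd : 2 / (α + 1) ≠ 0 := (div_pos two_pos hα₁).ne'
  refine ⟨IsUnit.of_mul_eq_one _ (smul_fromBlocks_diag_mul_inv hS ha hd), ?_⟩
  rw [trace_smul_fromBlocks_diag_mul_inv hS ha hd, Real.rpow_neg hα₁.le, Real.rpow_neg hα₂.le,
    Real.div_rpow hα₁.le hα₂.le, Fintype.card_fin, Fintype.card_unit]
  push_cast
  field_simp
end
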